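/- If κ is a weakly remarkable cardinal, then for every ordinal λ > κ and every set x ∈ V_λ there is an ordinal λ̄ and a generic elementary embedding j : V_λ̄ → V_λ such that j(crit(j)) = κ and x is in the range of j. -/

import Mathlib

/-!
Common framework for formalizing Wilson, "Weakly remarkable cardinals,
Erdős cardinals, and the generic Vopěnka principle".

We work in the universe of `ZSet` (Mathlib's model of ZFC).

* Ordinals and cardinals are von Neumann ordinals (`ZFSet.IsOrdinal`), and all
  notions are relativized to a universe class `U : Set ZSet` (take
  `U = Set.univ` for the real universe `V`, `U = LClass` for Gödel's `L`,
  or `U = M.toSet` for a transitive set model `M`).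

* "There is a generic elementary embedding `j : A → B` (i.e. one existing in a
  set-forcing extension) with `j ⊇ base` and pointwise constraint `C`" is
  rendered by `HasGenElemEmb`, via its standard ZFC-expressible equivalent:
  the existence of a "safe set" of finite partial elementary maps (positions
  from which the second player can survive forever in the finite-approximation
  game; equivalently, the statement forced by `Col(ω, A)`).
-/

noncomputable section

namespace GVP

/-- The universe of sets, monomorphized. -/
abbrev ZSet : Type 1 := ZFSet.{0}

/-- Formulas of the first-order language with a binary membership relation,
equality, and countably many unary predicate symbols, with `n` free
variables, de Bruijn style. -/
inductive Fml : ℕ → Type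
  | mem {n} (i j : Fin n) : Fml n
  | eq {n} (i j : Fin n) : Fml n
  | pred {n} (k : ℕ) (i : Fin n) : Fml n
  | not {n} (φ : Fml n) : Fml n
  | and {n} (φ ψ : Fml n) : Fml n
  | all {n} (φ : Fml (n + 1)) : Fml n

/-- An interpretation: a domain class of sets, a binary "membership" relation,
and interpretations for the unary predicate symbols. -/
structure Interp where
  dom : Set ZSet
  E : ZSet → ZSet → Prop
  P : ℕ → Set ZSet

/-- Tarskian satisfaction; quantifiers range over the domain of the
interpretation, and the fresh variable of `Fml.all` is variable `0`. -/
def Realize (I : Interp) : {n : ℕ} → Fml n → (Fin n → ZSet) → Prop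
  | _, .mem i j, v => I.E (v i) (v j)
  | _, .eq i j, v => v i = v j
  | _, .pred k i, v => v i ∈ I.P k
  | _, .not φ, v => ¬ Realize I φ v
  | _, .and φ ψ, v => Realize I φ v ∧ Realize I ψ v
  | _, .all φ, v => ∀ x ∈ I.dom, Realize I φ (Fin.cons x v)

/-- The pure membership interpretation on a domain `D`. -/
def memInterp (D : Set ZSet) : Interp :=
  ⟨D, fun a b => a ∈ b, fun _ => ∅⟩

/-- The membership interpretation on `D` with a unary predicate for the
class `A` (interpreting the structure `(D; ∈, A ∩ D)`). -/
def classInterp (D : Set ZSet) (A : Set ZSet) : Interp :=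
  ⟨D, fun a b => a ∈ b, fun k => if k = 0 then A else ∅⟩

/-- A finite sequence of pairs is a partial elementary map from `I` to `J`:
it preserves the truth of all first-order formulas. -/
def IsElemSeq (I J : Interp) {n : ℕ} (p : Fin n → ZSet × ZSet) : Prop :=
  (∀ i, (p i).1 ∈ I.dom) ∧ (∀ i, (p i).2 ∈ J.dom) ∧
    ∀ φ : Fml n, Realize I φ (fun i => (p i).1) ↔ Realize J φ (fun i => (p i).2)

/-- `HasGenElemEmb I J base C` formalizes: in some set-forcing extension there
is an elementary embedding `j : I → J` with `(a, j a) ∈ base` for each listed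
pair and with `C a (j a)` for every `a` in the domain.  This is rendered by
the standard ZFC-expressible equivalent: there is a set `S` of finite partial
elementary maps containing `base`, all of whose members satisfy the pointwise
constraint `C`, such that any member of `S` can be extended inside `S` so as
to put any prescribed element into the domain.  (In the collapse extension
making the domain countable, a union of a chain through `S` is the desired
embedding, and conversely the finite restrictions of a generic embedding
generate such an `S` in the ground model.) -/
def HasGenElemEmb (I J : Interp) (base : List (ZSet × ZSet))
    (C : ZSet → ZSet → Prop) : Prop :=
  ∃ S : Set ((n : ℕ) × (Fin n → ZSet × ZSet)),
    (∀ q ∈ S, IsElemSeq I J q.2 ∧ ∀ i, C (q.2 i).1 (q.2 i).2) ∧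
    (⟨base.length, base.get⟩ : (n : ℕ) × (Fin n → ZSet × ZSet)) ∈ S ∧
    ∀ q ∈ S, ∀ a ∈ I.dom, ∃ b ∈ J.dom,
      (⟨q.1 + 1, Fin.snoc q.2 (a, b)⟩ : (n : ℕ) × (Fin n → ZSet × ZSet)) ∈ S

/-- The pointwise constraint expressing that an embedding has critical point
(at least) `κ`: it fixes every von Neumann ordinal below `κ`. -/
def FixBelow (κ : ZSet) (a b : ZSet) : Prop :=
  (a.IsOrdinal ∧ a ∈ κ) → b = a

/-- The cumulative hierarchy, as classes: for an ordinal `l`, `VstageZ l` is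
the class of all sets of rank `< l`, i.e. `V_l`. -/
def VstageZ : ZSet → Set ZSet :=
  ZFSet.mem_wf.fix (C := fun _ => Set ZSet)
    fun l ih => {x | ∃ m, ∃ hm : m ∈ l, ∀ y ∈ x, y ∈ ih m hm}

/-- `V_l` relativized to the universe class `U`. -/
def VstageIn (U : Set ZSet) (l : ZSet) : Set ZSet :=
  {x | x ∈ U ∧ x ∈ VstageZ l}

/-- `x` is definable over the structure `(D; ∈)` with parameters from `D`. -/
def DefOver (D : Set ZSet) (x : ZSet) : Prop :=
  ∃ (n : ℕ) (φ : Fml (n + 1)) (a : Fin n → ZSet), (∀ i, a i ∈ D) ∧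
    ∀ y : ZSet, y ∈ x ↔ (y ∈ D ∧ Realize (memInterp D) φ (Fin.cons y a))

/-- The constructible hierarchy, as classes: for an ordinal `l`,
`Lstage l = ⋃_{m ∈ l} Def(L_m)`. -/
def Lstage : ZSet → Set ZSet :=
  ZFSet.mem_wf.fix (C := fun _ => Set ZSet)
    fun l ih => {x | ∃ m, ∃ hm : m ∈ l, (∀ y ∈ x, y ∈ ih m hm) ∧ DefOver (ih m hm) x}

/-- `x` is constructible. -/
def InL (x : ZSet) : Prop :=
  ∃ l : ZSet, l.IsOrdinal ∧ x ∈ Lstage l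

/-- Gödel's constructible universe, as a class. -/
def LClass : Set ZSet :=
  {x | InL x}

/-- A class is transitive. -/
def ClassTransitive (U : Set ZSet) : Prop :=
  ∀ x ∈ U, ∀ y ∈ x, y ∈ U

/-- `κ` is a cardinal from the point of view of the universe class `U`:
it is an ordinal and no set in `U` codes a covering of `κ` by a smaller
ordinal. -/
def ZCardIn (U : Set ZSet) (κ : ZSet) : Prop :=
  κ.IsOrdinal ∧ ∀ γ ∈ κ, ∀ F ∈ U, ∃ v ∈ κ, ∀ u ∈ γ, ZFSet.pair u v ∉ F

/-- `κ` is an infinite ordinal (`ω ≤ κ`). -/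
def ZInfinite (κ : ZSet) : Prop :=
  ZFSet.omega ∈ κ ∨ ZFSet.omega = κ

/-- `κ` is regular from the point of view of `U`: any total relation in `U`
from an ordinal `γ < κ` into `κ` is bounded below `κ`. -/
def ZRegularIn (U : Set ZSet) (κ : ZSet) : Prop :=
  κ.IsOrdinal ∧ ∀ γ ∈ κ, ∀ F ∈ U,
    (∀ u ∈ γ, ∃ v ∈ κ, ZFSet.pair u v ∈ F) →
    ∃ β ∈ κ, ∀ u ∈ γ, ∀ v ∈ κ, ZFSet.pair u v ∈ F → v ∈ β

/-- `κ` is a strong limit from the point of view of `U`: for `γ < κ` there are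
`δ < κ` and a relation in `U` covering all subsets of `γ` lying in `U` from
`δ` (i.e. `2^γ < κ` in `U`). -/
def ZStrongLimitIn (U : Set ZSet) (κ : ZSet) : Prop :=
  κ.IsOrdinal ∧ ∀ γ ∈ κ, ∃ δ ∈ κ, ∃ F ∈ U,
    ∀ x ∈ U, (∀ y ∈ x, y ∈ γ) → ∃ u ∈ δ, ZFSet.pair u x ∈ F

/-- `κ` is inaccessible from the point of view of `U`. -/
def ZInaccessibleIn (U : Set ZSet) (κ : ZSet) : Prop :=
  ZCardIn U κ ∧ ZFSet.omega ∈ κ ∧ ZRegularIn U κ ∧ ZStrongLimitIn U κ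

/-- `κ` is `Σ₂`-reflecting from the point of view of `U`: it is inaccessible
and `V_κ ≺_{Σ₂} V`, via the standard characterization: every statement with a
parameter `x ∈ V_κ` true in some `V_λ` is true in some `V_λ̄` with `λ̄ < κ`. -/
def Sigma2ReflectingIn (U : Set ZSet) (κ : ZSet) : Prop :=
  ZInaccessibleIn U κ ∧
    ∀ (φ : Fml 1) (l x : ZSet), l.IsOrdinal → l ∈ U → x ∈ U →
      x ∈ VstageZ κ → x ∈ VstageZ l →
      Realize (memInterp (VstageIn U l)) φ (fun _ => x) →
      ∃ lbar : ZSet, lbar.IsOrdinal ∧ lbar ∈ κ ∧ x ∈ VstageZ lbar ∧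
        Realize (memInterp (VstageIn U lbar)) φ (fun _ => x)

/-- `κ` is weakly remarkable (relative to the universe class `U`): for every
ordinal `λ > κ` there are an ordinal `λ̄` and a generic elementary embedding
`j : V_λ̄ → V_λ` with `j (crit j) = κ`, i.e. for some ordinal `κ̄ ≠ κ`, `j`
fixes all ordinals below `κ̄` and sends `κ̄` to `κ`. -/
def WeaklyRemarkableIn (U : Set ZSet) (κ : ZSet) : Prop :=
  ∀ l : ZSet, l.IsOrdinal → l ∈ U → κ ∈ l →
    ∃ lbar kbar : ZSet, lbar.IsOrdinal ∧ lbar ∈ U ∧ kbar.IsOrdinal ∧ kbar ≠ κ ∧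
      HasGenElemEmb (memInterp (VstageIn U lbar)) (memInterp (VstageIn U l))
        [(kbar, κ)] (FixBelow kbar)

/-- `κ` is remarkable (relative to `U`): as in `WeaklyRemarkableIn`, but
moreover `λ̄ < κ`. -/
def RemarkableIn (U : Set ZSet) (κ : ZSet) : Prop :=
  ∀ l : ZSet, l.IsOrdinal → l ∈ U → κ ∈ l →
    ∃ lbar kbar : ZSet, lbar.IsOrdinal ∧ lbar ∈ κ ∧ kbar.IsOrdinal ∧ kbar ≠ κ ∧
      HasGenElemEmb (memInterp (VstageIn U lbar)) (memInterp (VstageIn U l))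
        [(kbar, κ)] (FixBelow kbar)

/-- `κ` is weakly virtually `A`-extendible (relative to `U`): for every
ordinal `λ > κ` there are an ordinal `θ` and a generic elementary embedding
`j : (V_λ; ∈, A ∩ V_λ) → (V_θ; ∈, A ∩ V_θ)` with `crit j = κ`. -/
def WVExtendibleIn (U : Set ZSet) (A : Set ZSet) (κ : ZSet) : Prop :=
  ∀ l : ZSet, l.IsOrdinal → l ∈ U → κ ∈ l →
    ∃ θ κ' : ZSet, θ.IsOrdinal ∧ θ ∈ U ∧ κ' ≠ κ ∧
      HasGenElemEmb (classInterp (VstageIn U l) A) (classInterp (VstageIn U θ) A)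
        [(κ, κ')] (FixBelow κ)

/-- `s` is a finite set. -/
def ZFinite (s : ZSet) : Prop :=
  s.toSet.Finite

/-- The (set coding a) function `F` takes value `v` at `s`. -/
def ZFunVal (F s v : ZSet) : Prop :=
  ZFSet.pair s v ∈ F ∧ ∀ v', ZFSet.pair s v' ∈ F → v' = v

/-- `c` is a club in the ordinal `η`: a subset of `η`, unbounded in `η` and
containing all of its limit points below `η`. -/
def ZClubIn (η c : ZSet) : Prop :=
  (∀ x ∈ c, x ∈ η) ∧ (∀ a ∈ η, ∃ b ∈ c, a ∈ b ∨ a = b) ∧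
    ∀ a ∈ η, a ≠ ∅ → (∀ b ∈ a, ∃ d ∈ c, b ∈ d ∧ d ∈ a) → a ∈ c

/-- A set of ordinals has order type `ω`: it is infinite but each of its
elements has only finitely many predecessors in it. -/
def ZOrderTypeOmega (X : ZSet) : Prop :=
  ¬ X.toSet.Finite ∧ ∀ x ∈ X, {y : ZSet | y ∈ X ∧ y ∈ x}.Finite

/-- `X` is homogeneous for the function (coded by) `F` on finite sets:
`F` gives equal values to nonempty finite subsets of `X` of the same size. -/
def ZHomogeneousFor (F X : ZSet) : Prop :=
  ∀ s t : ZSet, ZFinite s → ZFinite t → s ≠ ∅ → t ≠ ∅ →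
    (∀ x ∈ s, x ∈ X) → (∀ x ∈ t, x ∈ X) → s.toSet.ncard = t.toSet.ncard →
    ∃ v, ZFSet.pair s v ∈ F ∧ ZFSet.pair t v ∈ F

/-- `η` is an `ω`-Erdős cardinal from the point of view of the universe class
`U` (Baumgartner): it is an infinite cardinal such that for every club `c` in
`η` lying in `U` and every regressive function `F ∈ U` on the finite subsets
of `c`, there is a homogeneous `X ∈ U`, `X ⊆ c`, of order type `ω`. -/
def IsOmegaErdosIn (U : Set ZSet) (η : ZSet) : Prop :=
  η ∈ U ∧ ZCardIn U η ∧ ZInfinite η ∧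
    ∀ c ∈ U, ∀ F ∈ U, ZClubIn η c →
      (∀ s : ZSet, ZFinite s → s ≠ ∅ → (∀ x ∈ s, x ∈ c) →
        ∃ v, ZFunVal F s v ∧ ∀ x ∈ s, v ∈ x) →
      ∃ X ∈ U, (∀ x ∈ X, x ∈ c) ∧ ZOrderTypeOmega X ∧ ZHomogeneousFor F X

/-- `F` codes a total function from the finite subsets of `β` into `κ`. -/
def ZColoring (F β κ : ZSet) : Prop :=
  ∀ s : ZSet, ZFinite s → (∀ x ∈ s, x ∈ β) → ∃ v, v ∈ κ ∧ ZFunVal F s v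

/-- The partition relation `β → (ω)^{<ω}_κ` holds in `L`: every constructible
coloring of the finite subsets of `β` in `κ` colors has a constructible
homogeneous set of order type `ω`. -/
def PartitionOmegaInL (β κ : ZSet) : Prop :=
  ∀ F : ZSet, InL F → ZColoring F β κ →
    ∃ X : ZSet, InL X ∧ (∀ x ∈ X, x ∈ β) ∧ ZOrderTypeOmega X ∧ ZHomogeneousFor F X

/-- `κ` is ineffable (relative to `U`): for every sequence `⟨A_α ⊆ α : α < κ⟩`
in `U` there is `B ⊆ κ` in `U` such that `{α < κ : A_α = B ∩ α}` is
stationary in `κ` (meets every club of `κ` lying in `U`). -/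
def IneffableIn (U : Set ZSet) (κ : ZSet) : Prop :=
  ZCardIn U κ ∧
    ∀ A ∈ U, (∀ α ∈ κ, ∃ s, ZFunVal A α s ∧ ∀ y ∈ s, y ∈ α) →
      ∃ B ∈ U, (∀ y ∈ B, y ∈ κ) ∧
        ∀ c ∈ U, ZClubIn κ c →
          ∃ α ∈ c, ∃ s, ZFunVal A α s ∧ ∀ y, y ∈ s ↔ (y ∈ B ∧ y ∈ α)

/-- The universe class `U` satisfies all axioms of ZFC (semantically, with the
separation and replacement schemes ranging over all first-order formulas). -/
def SatisfiesZFCIn (U : Set ZSet) : Prop :=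
  (∃ x, x ∈ U) ∧
  (∀ x ∈ U, ∀ y ∈ U, (∀ z ∈ U, z ∈ x ↔ z ∈ y) → x = y) ∧
  (∀ x ∈ U, ∀ y ∈ U, ∃ p ∈ U, ∀ z ∈ U, z ∈ p ↔ (z = x ∨ z = y)) ∧
  (∀ x ∈ U, ∃ u ∈ U, ∀ z ∈ U, z ∈ u ↔ ∃ y ∈ U, y ∈ x ∧ z ∈ y) ∧
  (∀ x ∈ U, ∃ p ∈ U, ∀ z ∈ U, z ∈ p ↔ ∀ w ∈ U, w ∈ z → w ∈ x) ∧
  (∃ w ∈ U, (∃ e ∈ U, e ∈ w ∧ ∀ t ∈ U, t ∉ e) ∧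
    ∀ u ∈ U, u ∈ w → ∃ v ∈ U, v ∈ w ∧ ∀ t ∈ U, (t ∈ v ↔ (t ∈ u ∨ t = u))) ∧
  (∀ x ∈ U, (∃ y ∈ U, y ∈ x) → ∃ y ∈ U, y ∈ x ∧ ¬ ∃ z ∈ U, z ∈ y ∧ z ∈ x) ∧
  (∀ (n : ℕ) (φ : Fml (n + 1)) (a : Fin n → ZSet), (∀ i, a i ∈ U) →
    ∀ x ∈ U, ∃ b ∈ U, ∀ z ∈ U,
      z ∈ b ↔ (z ∈ x ∧ Realize (memInterp U) φ (Fin.cons z a))) ∧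
  (∀ (n : ℕ) (φ : Fml (n + 2)) (a : Fin n → ZSet), (∀ i, a i ∈ U) →
    ∀ x ∈ U,
      (∀ z ∈ U, z ∈ x → ∃ w ∈ U,
        Realize (memInterp U) φ (Fin.cons z (Fin.cons w a)) ∧
        ∀ w' ∈ U, Realize (memInterp U) φ (Fin.cons z (Fin.cons w' a)) → w' = w) →
      ∃ b ∈ U, ∀ w ∈ U, w ∈ b ↔
        ∃ z ∈ U, z ∈ x ∧ Realize (memInterp U) φ (Fin.cons z (Fin.cons w a))) ∧
  (∀ x ∈ U, (∀ y ∈ U, y ∈ x → ∃ z ∈ U, z ∈ y) →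
    (∀ y ∈ U, y ∈ x → ∀ y' ∈ U, y' ∈ x → y ≠ y' → ¬ ∃ z ∈ U, z ∈ y ∧ z ∈ y') →
    ∃ c ∈ U, ∀ y ∈ U, y ∈ x →
      ∃ z ∈ U, z ∈ y ∧ z ∈ c ∧ ∀ z' ∈ U, z' ∈ y → z' ∈ c → z' = z)

/-- `s` codes the structure `(M; E, P)` (a set with a binary relation and a
unary predicate). -/
def CodesStructure (s M E P : ZSet) : Prop :=
  s = ZFSet.pair M (ZFSet.pair E P) ∧
    (∀ e ∈ E, ∃ a ∈ M, ∃ b ∈ M, e = ZFSet.pair a b) ∧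
    (∀ p ∈ P, p ∈ M)

/-- The interpretation associated to a coded structure. -/
def structInterp (M E P : ZSet) : Interp :=
  ⟨M.toSet, fun a b => ZFSet.pair a b ∈ E, fun k => if k = 0 then {p | p ∈ P} else ∅⟩

/-- `C` is a proper class relative to `U`: a subclass of `U` not covered by
any set in `U`. -/
def ProperClassIn (U : Set ZSet) (C : Set ZSet) : Prop :=
  (∀ s ∈ C, s ∈ U) ∧ ∀ z ∈ U, ∃ s ∈ C, s ∉ z

/-- The generic Vopěnka principle for the classes in `Classes`, relative to
the universe class `U`: for every proper class `C ∈ Classes` of structures of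
the same type, there is a generic elementary embedding of one member of `C`
into another. -/
def gVPIn (U : Set ZSet) (Classes : Set (Set ZSet)) : Prop :=
  ∀ C ∈ Classes,
    (∀ s ∈ C, ∃ M E P : ZSet, M ∈ U ∧ E ∈ U ∧ P ∈ U ∧ CodesStructure s M E P) →
    ProperClassIn U C →
    ∃ s ∈ C, ∃ t ∈ C, s ≠ t ∧
      ∃ M₁ E₁ P₁ M₂ E₂ P₂ : ZSet, CodesStructure s M₁ E₁ P₁ ∧
        CodesStructure t M₂ E₂ P₂ ∧
        HasGenElemEmb (structInterp M₁ E₁ P₁) (structInterp M₂ E₂ P₂) []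
          (fun _ _ => True)

/-- `Δ₀` formulas of the language of set theory: only bounded quantifiers
(`Fml0.ball i φ` is `∀ x ∈ v_i, φ`, the fresh variable being variable `0`). -/
inductive Fml0 : ℕ → Type
  | mem {n} (i j : Fin n) : Fml0 n
  | eq {n} (i j : Fin n) : Fml0 n
  | not {n} (φ : Fml0 n) : Fml0 n
  | and {n} (φ ψ : Fml0 n) : Fml0 n
  | ball {n} (i : Fin n) (φ : Fml0 (n + 1)) : Fml0 n

/-- Satisfaction for `Δ₀` formulas (absolute, so no universe is needed). -/
def Realize0 : {n : ℕ} → Fml0 n → (Fin n → ZSet) → Prop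
  | _, .mem i j, v => v i ∈ v j
  | _, .eq i j, v => v i = v j
  | _, .not φ, v => ¬ Realize0 φ v
  | _, .and φ ψ, v => Realize0 φ v ∧ Realize0 ψ v
  | _, .ball i φ, v => ∀ x, x ∈ v i → Realize0 φ (Fin.cons x v)

/-- `C` is a `Π₁`-definable class (with set parameters from `U`), relative to
the universe class `U`. Variable `0` is the distinguished free variable. -/
def IsPi1ClassIn (U : Set ZSet) (C : Set ZSet) : Prop :=
  ∃ (m k : ℕ) (φ : Fml0 (m + k + 1)) (p : Fin k → ZSet), (∀ i, p i ∈ U) ∧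
    ∀ x ∈ U, (x ∈ C ↔ ∀ y : Fin m → ZSet, (∀ i, y i ∈ U) →
      Realize0 φ (Fin.cons x (Fin.append y p)))

/-- `C` is a `Σ₂`-definable class (with set parameters from `U`). -/
def IsSigma2ClassIn (U : Set ZSet) (C : Set ZSet) : Prop :=
  ∃ (m m' k : ℕ) (φ : Fml0 (m + (m' + k) + 1)) (p : Fin k → ZSet),
    (∀ i, p i ∈ U) ∧
    ∀ x ∈ U, (x ∈ C ↔ ∃ y : Fin m → ZSet, (∀ i, y i ∈ U) ∧
      ∀ z : Fin m' → ZSet, (∀ i, z i ∈ U) →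
        Realize0 φ (Fin.cons x (Fin.append y (Fin.append z p))))

/-- `C` is a `Π₂`-definable class (with set parameters from `U`). -/
def IsPi2ClassIn (U : Set ZSet) (C : Set ZSet) : Prop :=
  ∃ (m m' k : ℕ) (φ : Fml0 (m + (m' + k) + 1)) (p : Fin k → ZSet),
    (∀ i, p i ∈ U) ∧
    ∀ x ∈ U, (x ∈ C ↔ ∀ y : Fin m → ZSet, (∀ i, y i ∈ U) →
      ∃ z : Fin m' → ZSet, (∀ i, z i ∈ U) ∧
        Realize0 φ (Fin.cons x (Fin.append y (Fin.append z p))))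

/-- `C` is a club class of ordinals relative to `U`: a class of ordinals,
unbounded among the ordinals of `U`, and closed under limits. -/
def OrdClubClassIn (U : Set ZSet) (C : Set ZSet) : Prop :=
  (∀ x ∈ C, x ∈ U ∧ x.IsOrdinal) ∧
  (∀ a : ZSet, a.IsOrdinal → a ∈ U → ∃ b ∈ C, a ∈ b ∨ a = b) ∧
  (∀ a : ZSet, a.IsOrdinal → a ∈ U → a ≠ ∅ →
    (∀ b ∈ a, ∃ d ∈ C, b ∈ d ∧ d ∈ a) → a ∈ C)

/-- "Ord is `Δ₂`-Mahlo" relative to `U`: every `Δ₂`-definable club class of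
ordinals contains a regular cardinal. -/
def OrdIsDelta2MahloIn (U : Set ZSet) : Prop :=
  ∀ C : Set ZSet, IsSigma2ClassIn U C → IsPi2ClassIn U C → OrdClubClassIn U C →
    ∃ ρ ∈ C, ZCardIn U ρ ∧ ZRegularIn U ρ

/-- `(U, Cls)` is a model of Gödel–Bernays class theory with global choice
(GBC): `U` is a transitive model of ZFC, the classes in `Cls` are subclasses
of `U` including all sets, closed under first-order comprehension (with set
and class parameters), satisfying class replacement, and one of them is a
global choice function. -/
def IsGBCModel (U : Set ZSet) (Cls : Set (Set ZSet)) : Prop :=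
  ClassTransitive U ∧ SatisfiesZFCIn U ∧
  (∀ X ∈ Cls, ∀ x ∈ X, x ∈ U) ∧
  (∀ x ∈ U, {y : ZSet | y ∈ x} ∈ Cls) ∧
  (∀ P : ℕ → Set ZSet, (∀ k, P k ∈ Cls) →
    ∀ (n : ℕ) (φ : Fml (n + 1)) (a : Fin n → ZSet), (∀ i, a i ∈ U) →
      {x : ZSet | x ∈ U ∧ Realize ⟨U, fun u v => u ∈ v, P⟩ φ (Fin.cons x a)} ∈ Cls) ∧
  (∀ X ∈ Cls, (∀ u v v' : ZSet, ZFSet.pair u v ∈ X → ZFSet.pair u v' ∈ X → v = v') →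
    ∀ x ∈ U, ∃ b ∈ U, ∀ w ∈ U, w ∈ b ↔ ∃ z ∈ U, z ∈ x ∧ ZFSet.pair z w ∈ X) ∧
  (∃ G ∈ Cls, ∀ x ∈ U, (∃ z ∈ U, z ∈ x) →
    ∃ z ∈ U, z ∈ x ∧ ZFSet.pair x z ∈ G ∧ ∀ z' ∈ U, ZFSet.pair x z' ∈ G → z' = z)

/-- The definable classes of the structure `(U; ∈)` (with set parameters). -/
def DefClasses (U : Set ZSet) : Set (Set ZSet) :=
  {C | ∃ (n : ℕ) (φ : Fml (n + 1)) (a : Fin n → ZSet), (∀ i, a i ∈ U) ∧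
    C = {x : ZSet | x ∈ U ∧ Realize (memInterp U) φ (Fin.cons x a)}}

/-- Turn a list of sets into the ZF set with exactly those elements. -/
def listToZSet (l : List ZSet) : ZSet :=
  l.foldr insert ∅

end GVP

end

namespace GVP

/-! ### Uniformly definable relations -/

/-- The membership structure on a set. -/
abbrev setInterp (W : ZSet) : Interp :=
  memInterp {x | x ∈ W}

/-- A relation on tuples, depending on an ambient set `W`, is uniformly definable if a single
formula, evaluated in `(W; ∈)`, defines it for all `W`. -/
def UniformlyDefinable {n : ℕ} (R : ZSet → (Fin n → ZSet) → Prop) : Prop :=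
  ∃ φ : Fml n, ∀ W v, Realize (setInterp W) φ v ↔ R W v

namespace UniformlyDefinable

variable {n : ℕ} {R R' : ZSet → (Fin n → ZSet) → Prop}

theorem mem (i j : Fin n) : UniformlyDefinable (fun _ w => w i ∈ w j) :=
  ⟨.mem i j, fun _ _ => Iff.rfl⟩

theorem eq (i j : Fin n) : UniformlyDefinable (fun _ w => w i = w j) :=
  ⟨.eq i j, fun _ _ => Iff.rfl⟩

theorem not (h : UniformlyDefinable R) : UniformlyDefinable (fun W w => ¬ R W w) := by
  obtain ⟨φ, hφ⟩ := h
  exact ⟨.not φ, fun W v => by simp only [Realize, hφ]⟩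

theorem and (h : UniformlyDefinable R) (h' : UniformlyDefinable R') :
    UniformlyDefinable (fun W w => R W w ∧ R' W w) := by
  obtain ⟨φ, hφ⟩ := h
  obtain ⟨ψ, hψ⟩ := h'
  exact ⟨.and φ ψ, fun W v => by simp only [Realize, hφ, hψ]⟩

theorem congr (h : UniformlyDefinable R) (hR : ∀ W w, R W w ↔ R' W w) :
    UniformlyDefinable R' := by
  obtain ⟨φ, hφ⟩ := h
  exact ⟨φ, fun W v => by rw [hφ, hR]⟩

theorem or (h : UniformlyDefinable R) (h' : UniformlyDefinable R') :
    UniformlyDefinable (fun W w => R W w ∨ R' W w) :=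
  (h.not.and h'.not).not.congr fun _ _ => by tauto

theorem imp (h : UniformlyDefinable R) (h' : UniformlyDefinable R') :
    UniformlyDefinable (fun W w => R W w → R' W w) :=
  (h.and h'.not).not.congr fun _ _ => by tauto

theorem iff (h : UniformlyDefinable R) (h' : UniformlyDefinable R') :
    UniformlyDefinable (fun W w => R W w ↔ R' W w) :=
  ((h.imp h').and (h'.imp h)).congr fun _ _ => by tauto

theorem all {Q : ZSet → (Fin n → ZSet) → ZSet → Prop}
    (h : UniformlyDefinable (n := n + 1) (fun W w => Q W (Fin.tail w) (w 0))) :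
    UniformlyDefinable (fun W w => ∀ x ∈ W, Q W w x) := by
  obtain ⟨φ, hφ⟩ := h
  refine ⟨.all φ, fun W v => forall₂_congr fun x _ => ?_⟩
  exact hφ W (Fin.cons x v)

theorem ex {Q : ZSet → (Fin n → ZSet) → ZSet → Prop}
    (h : UniformlyDefinable (n := n + 1) (fun W w => Q W (Fin.tail w) (w 0))) :
    UniformlyDefinable (fun W w => ∃ x ∈ W, Q W w x) :=
  (all (Q := fun W w x => ¬ Q W w x) h.not).not.congr fun _ _ => by push Not; rfl

theorem const (p : Prop) : UniformlyDefinable (n := n) (fun _ _ => p) := by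
  have htrue : UniformlyDefinable (n := n) (fun W _ => ∀ x ∈ W, x = x) := all (eq 0 0)
  by_cases hp : p
  · exact htrue.congr fun _ _ => by simp [hp]
  · exact htrue.not.congr fun _ _ => by simp [hp]

theorem forall_finite {ι : Type*} [Finite ι] {Q : ι → ZSet → (Fin n → ZSet) → Prop}
    (h : ∀ i, UniformlyDefinable (Q i)) : UniformlyDefinable (fun W w => ∀ i, Q i W w) := by
  classical
  have := Fintype.ofFinite ι
  have key : ∀ s : Finset ι, UniformlyDefinable (fun W w => ∀ i ∈ s, Q i W w) := by
    intro s
    induction s using Finset.induction_on with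
    | empty => exact (const True).congr fun _ _ => by simp
    | insert a s _ ih =>
      exact ((h a).and ih).congr fun _ _ => by simp
  exact (key Finset.univ).congr fun _ _ => by simp

/-- Satisfaction in a substructure `(W ∩ M; ∈)` is definable over `(W; ∈)` from `M`. -/
theorem realize_inter {m : ℕ} (φ : Fml m) (f : Fin m → Fin n) (i₀ : Fin n) :
    UniformlyDefinable
      (fun W w => Realize (memInterp {x | x ∈ W ∧ x ∈ w i₀}) φ (fun i => w (f i))) := by
  induction φ generalizing n with
  | mem i j => exact mem _ _
  | eq i j => exact eq _ _
  | pred k i => exact (const False).congr fun _ _ => by simp [Realize, memInterp]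
  | not φ ih => exact (ih f i₀).not
  | and φ ψ ih ih' => exact (ih f i₀).and (ih' f i₀)
  | all φ ih =>
    have step := ih (Fin.cons 0 (fun i => (f i).succ)) i₀.succ
    refine (all (Q := fun W w x => x ∈ w i₀ → Realize (memInterp {x | x ∈ W ∧ x ∈ w i₀}) φ
      (Fin.cons x fun i => w (f i))) ((mem 0 i₀.succ).imp (step.congr fun W w => ?_))).congr
      fun W w => ?_
    · have : (fun i => w ((Fin.cons 0 (fun i => (f i).succ) : Fin _ → Fin (_ + 1)) i)) =
          (Fin.cons (w 0) fun i => Fin.tail w (f i) : Fin _ → ZSet) := by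
        funext i
        refine Fin.cases ?_ (fun i => ?_) i <;> simp [Fin.tail]
      rw [this]
      rfl
    · exact ⟨fun h x hx => h x hx.1 hx.2, fun h x hx hx' => h x ⟨hx, hx'⟩⟩

end UniformlyDefinable

/-- Partial elementary maps preserve uniformly definable relations of finitely many of their
pairs. -/
theorem IsElemSeq.iff_of_uniformlyDefinable {A B : ZSet} {n : ℕ} {p : Fin n → ZSet × ZSet}
    (hp : IsElemSeq (setInterp A) (setInterp B) p) {R : ZSet → (Fin n → ZSet) → Prop}
    (hR : UniformlyDefinable R) : R A (fun i => (p i).1) ↔ R B (fun i => (p i).2) := by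
  obtain ⟨φ, hφ⟩ := hR
  rw [← hφ, ← hφ]
  exact hp.2.2 φ

theorem IsElemSeq.mem_iff_mem {A B : ZSet} {n : ℕ} {p : Fin n → ZSet × ZSet}
    (hp : IsElemSeq (setInterp A) (setInterp B) p) (i j : Fin n) :
    (p i).1 ∈ (p j).1 ↔ (p i).2 ∈ (p j).2 :=
  hp.iff_of_uniformlyDefinable (UniformlyDefinable.mem i j)

/-! ### Types of bounded quantifier rank -/

/-- The possible types, of quantifier rank `k`, of `n`-tuples. -/
def RankType : ℕ → ℕ → Type
  | 0, n => Fin n → Fin n → Prop × Prop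
  | k + 1, n => Set (RankType k (n + 1))

instance RankType.instFinite : ∀ k n, Finite (RankType k n)
  | 0, n => inferInstanceAs (Finite (Fin n → Fin n → Prop × Prop))
  | k + 1, n =>
    have := RankType.instFinite k (n + 1)
    inferInstanceAs (Finite (Set (RankType k (n + 1))))

/-- The type of quantifier rank `k` of a tuple in `(W; ∈)`. -/
def rankType : (k : ℕ) → {n : ℕ} → ZSet → (Fin n → ZSet) → RankType k n
  | 0, _, _, v => fun i j => (v i ∈ v j, v i = v j)
  | k + 1, _, W, v => {t | ∃ x ∈ W, rankType k W (Fin.cons x v : Fin (_ + 1) → ZSet) = t}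

theorem uniformlyDefinable_rankType_eq (k : ℕ) {n : ℕ} (t : RankType k n) :
    UniformlyDefinable (fun W w => rankType k W w = t) := by
  induction k generalizing n with
  | zero =>
    refine (UniformlyDefinable.forall_finite fun i => UniformlyDefinable.forall_finite fun j =>
      ((UniformlyDefinable.mem i j).iff (.const (t i j).1)).and
        ((UniformlyDefinable.eq i j).iff (.const (t i j).2))).congr fun W w => ?_
    constructor
    · intro h
      funext i j
      exact Prod.ext (propext (h i j).1) (propext (h i j).2)
    · rintro rfl i j
      exact ⟨Iff.rfl, Iff.rfl⟩
  | succ k ih =>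
    refine (UniformlyDefinable.forall_finite fun s : RankType k (n + 1) =>
      (UniformlyDefinable.ex (Q := fun W w x => rankType k W (Fin.cons x w) = s)
        ((ih s).congr fun W w => ?_)).iff (.const (s ∈ (show Set (RankType k (n + 1)) from t)))).congr
      fun W w => ?_
    · rw [Fin.cons_self_tail]
    · exact (Set.ext_iff (a := {s | ∃ x ∈ W, rankType k W (Fin.cons x w) = s})
        (b := (show Set (RankType k (n + 1)) from t))).symm

theorem IsElemSeq.rankType_eq {A B : ZSet} {n : ℕ} {p : Fin n → ZSet × ZSet}
    (hp : IsElemSeq (setInterp A) (setInterp B) p) (k : ℕ) :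
    rankType k A (fun i => (p i).1) = rankType k B (fun i => (p i).2) :=
  ((hp.iff_of_uniformlyDefinable (uniformlyDefinable_rankType_eq k _)).1 rfl).symm

/-! ### Internal statements -/

/-- `z` is the Kuratowski pair of `a` and `b`, as seen in `W`. -/
def IsPairIn (W z a b : ZSet) : Prop :=
  ∀ u ∈ W, u ∈ z ↔ (∀ t ∈ W, t ∈ u ↔ t = a) ∨ (∀ t ∈ W, t ∈ u ↔ t = a ∨ t = b)

/-- The pair of `a` and `b` belongs to `p`, as seen in `W`. -/
def PairMemIn (W p a b : ZSet) : Prop :=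
  ∃ z ∈ W, z ∈ p ∧ IsPairIn W z a b

/-- `v` is a stage of the cumulative hierarchy, as seen in `W`, witnessed by the set of its
earlier stages. -/
def IsStageIn (W v : ZSet) : Prop :=
  ∃ H ∈ W,
    (∀ z ∈ W, z ∈ H → ∀ y ∈ W, y ∈ z ↔ ∃ u ∈ W, u ∈ H ∧ u ∈ z ∧ ∀ t ∈ W, t ∈ y → t ∈ u) ∧
    ∀ y ∈ W, y ∈ v ↔ ∃ u ∈ W, u ∈ H ∧ ∀ t ∈ W, t ∈ y → t ∈ u

/-- `v` is an ordinal, as seen in `W`. -/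
def IsOrdinalIn (W v : ZSet) : Prop :=
  (∀ y ∈ W, y ∈ v → ∀ z ∈ W, z ∈ y → z ∈ v) ∧
    ∀ z ∈ W, z ∈ v → ∀ y ∈ W, y ∈ z → ∀ x ∈ W, x ∈ y → x ∈ z

/-- `p` can be extended inside `E` so as to put any element of `M'` into its domain, as seen
in `W`. -/
def ForthIn (W M' M E p : ZSet) : Prop :=
  ∀ a ∈ W, a ∈ M' → ∃ b ∈ W, b ∈ M ∧ ∃ p' ∈ W, p' ∈ E ∧ PairMemIn W p' a b ∧
    ∀ z ∈ W, z ∈ p → z ∈ p'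

/-- `p` can be extended inside `E` so as to put any element of `M` into its range, as seen
in `W`. -/
def BackIn (W M' M E p : ZSet) : Prop :=
  ∀ b ∈ W, b ∈ M → ∃ a ∈ W, a ∈ M' ∧ ∃ p' ∈ W, p' ∈ E ∧ PairMemIn W p' a b ∧
    ∀ z ∈ W, z ∈ p → z ∈ p'

/-- `p` is a partial isomorphism, as seen in `W`. -/
def IsPartialIsoIn (W p : ZSet) : Prop :=
  ∀ a ∈ W, ∀ b ∈ W, PairMemIn W p a b → ∀ c ∈ W, ∀ d ∈ W, PairMemIn W p c d →
    (a ∈ c ↔ b ∈ d) ∧ (a = c ↔ b = d)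

/-- `F` is a family of sets of partial isomorphisms between `M'` and `M`, each of which has a
subset in `F` whose members have the back-and-forth property into it, as seen in `W`. -/
def IsBackAndForthIn (W M' M F : ZSet) : Prop :=
  (∃ E ∈ W, E ∈ F) ∧
    (∀ E ∈ W, E ∈ F → ∃ E' ∈ W, E' ∈ F ∧ (∀ p ∈ W, p ∈ E' → p ∈ E) ∧
      ∀ p ∈ W, p ∈ E' → ForthIn W M' M E p ∧ BackIn W M' M E p) ∧
    ∀ E ∈ W, E ∈ F → ∀ p ∈ W, p ∈ E → IsPartialIsoIn W p

/-- The members of `p` are pairs in `M' × M` with equal coordinates if the first one is in `k'`,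
as seen in `W`. -/
def IsAdmissibleIn (W M' k' M p : ZSet) : Prop :=
  ∀ a ∈ W, ∀ b ∈ W, PairMemIn W p a b → a ∈ M' ∧ b ∈ M ∧ (a ∈ k' → b = a)

/-- There is a generic elementary embedding of `M'` into `M` with critical point at least `k'`
that maps `k'` to `k` and `x'` to `x`, as seen in `W`. -/
def HasEmbeddingIn (W M' k' x' M k x : ZSet) : Prop :=
  ∃ S ∈ W, ∃ F ∈ W,
    (∃ p ∈ W, p ∈ S ∧ PairMemIn W p k' k ∧ PairMemIn W p x' x) ∧
    (∀ p ∈ W, p ∈ S → ForthIn W M' M S p ∧ IsAdmissibleIn W M' k' M p ∧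
      ∀ E ∈ W, E ∈ F → p ∈ E) ∧
    IsBackAndForthIn W M' M F

/-- `M` is a stage containing `k` and `x` such that no generic elementary embedding of a stage
into `M` maps its critical point to `k` and has `x` in its range, as seen in `W`. -/
def IsCounterexampleIn (W k M x : ZSet) : Prop :=
  IsStageIn W M ∧ k ∈ M ∧ x ∈ M ∧
    ∀ M' ∈ W, ∀ k' ∈ W, ∀ x' ∈ W, IsStageIn W M' → IsOrdinalIn W k' → ¬ k' = k → k' ∈ M' →
      x' ∈ M' → ¬ HasEmbeddingIn W M' k' x' M k x

namespace UniformlyDefinable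

variable {n : ℕ}

theorem isPairIn (i j k : Fin n) :
    UniformlyDefinable (fun W w => IsPairIn W (w i) (w j) (w k)) :=
  all <| (mem _ _).iff <| .or (all <| (mem _ _).iff (eq _ _))
    (all <| (mem _ _).iff <| .or (eq _ _) (eq _ _))

theorem pairMemIn (i j k : Fin n) :
    UniformlyDefinable (fun W w => PairMemIn W (w i) (w j) (w k)) :=
  ex <| (mem _ _).and (isPairIn _ _ _)

theorem isStageIn (i : Fin n) : UniformlyDefinable (fun W w => IsStageIn W (w i)) :=
  ex <| .and (all <| (mem _ _).imp <| all <| (mem _ _).iff <| ex <| (mem _ _).and <|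
      (mem _ _).and <| all <| (mem _ _).imp (mem _ _))
    (all <| (mem _ _).iff <| ex <| (mem _ _).and <| all <| (mem _ _).imp (mem _ _))

theorem isOrdinalIn (i : Fin n) : UniformlyDefinable (fun W w => IsOrdinalIn W (w i)) :=
  .and (all <| (mem _ _).imp <| all <| (mem _ _).imp (mem _ _))
    (all <| (mem _ _).imp <| all <| (mem _ _).imp <| all <| (mem _ _).imp (mem _ _))

theorem forthIn (i j k l : Fin n) :
    UniformlyDefinable (fun W w => ForthIn W (w i) (w j) (w k) (w l)) :=
  all <| (mem _ _).imp <| ex <| (mem _ _).and <| ex <| (mem _ _).and <|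
    (pairMemIn _ _ _).and <| all <| (mem _ _).imp (mem _ _)

theorem backIn (i j k l : Fin n) :
    UniformlyDefinable (fun W w => BackIn W (w i) (w j) (w k) (w l)) :=
  all <| (mem _ _).imp <| ex <| (mem _ _).and <| ex <| (mem _ _).and <|
    (pairMemIn _ _ _).and <| all <| (mem _ _).imp (mem _ _)

theorem isPartialIsoIn (i : Fin n) : UniformlyDefinable (fun W w => IsPartialIsoIn W (w i)) :=
  all <| all <| (pairMemIn _ _ _).imp <| all <| all <| (pairMemIn _ _ _).imp <|
    .and ((mem _ _).iff (mem _ _)) ((eq _ _).iff (eq _ _))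

theorem isBackAndForthIn (i j k : Fin n) :
    UniformlyDefinable (fun W w => IsBackAndForthIn W (w i) (w j) (w k)) :=
  .and (ex (mem _ _)) <| .and
    (all <| (mem _ _).imp <| ex <| (mem _ _).and <| .and (all <| (mem _ _).imp (mem _ _))
      (all <| (mem _ _).imp <| (forthIn _ _ _ _).and (backIn _ _ _ _)))
    (all <| (mem _ _).imp <| all <| (mem _ _).imp (isPartialIsoIn _))

theorem isAdmissibleIn (i j k l : Fin n) :
    UniformlyDefinable (fun W w => IsAdmissibleIn W (w i) (w j) (w k) (w l)) :=
  all <| all <| (pairMemIn _ _ _).imp <| (mem _ _).and <| (mem _ _).and <|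
    (mem _ _).imp (eq _ _)

theorem hasEmbeddingIn (i j k l m o : Fin n) :
    UniformlyDefinable (fun W w => HasEmbeddingIn W (w i) (w j) (w k) (w l) (w m) (w o)) :=
  ex <| ex <| .and (ex <| (mem _ _).and <| (pairMemIn _ _ _).and (pairMemIn _ _ _)) <|
    .and (all <| (mem _ _).imp <| (forthIn _ _ _ _).and <| (isAdmissibleIn _ _ _ _).and <|
      all <| (mem _ _).imp (mem _ _)) (isBackAndForthIn _ _ _)

theorem isCounterexampleIn (i j k : Fin n) :
    UniformlyDefinable (fun W w => IsCounterexampleIn W (w i) (w j) (w k)) :=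
  (isStageIn _).and <| (mem _ _).and <| (mem _ _).and <| all <| all <| all <|
    (isStageIn _).imp <| (isOrdinalIn _).imp <| (eq _ _).not.imp <| (mem _ _).imp <|
      (mem _ _).imp (hasEmbeddingIn _ _ _ _ _ _).not

end UniformlyDefinable

/-! ### Absoluteness for stages of the cumulative hierarchy -/

section Absoluteness

open ZFSet Order

theorem mem_vstageZ (x l : ZSet) : x ∈ VstageZ l ↔ x ∈ V_ l.rank := by
  induction l using ZFSet.inductionOn generalizing x with
  | h l ih =>
    have hfix : VstageZ l = {x | ∃ m, ∃ _ : m ∈ l, ∀ y ∈ x, y ∈ VstageZ m} := by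
      unfold VstageZ
      rw [WellFounded.fix_eq]
    rw [hfix, mem_vonNeumann, ZFSet.lt_rank_iff]
    refine exists_congr fun m => ⟨fun ⟨hm, h⟩ => ⟨hm, ?_⟩, fun ⟨hm, h⟩ => ⟨hm, fun y hy => ?_⟩⟩
    · rw [← subset_vonNeumann]
      exact fun y hy => (ih m hm y).1 (h y hy)
    · exact (ih m hm y).2 (subset_vonNeumann.2 h hy)

theorem vstageIn_univ (l : ZSet) : VstageIn Set.univ l = {x | x ∈ V_ l.rank} := by
  ext x
  exact (and_iff_right (Set.mem_univ x)).trans (mem_vstageZ x l)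

variable {θ : Ordinal.{0}}

theorem mem_vonNeumann_of_mem {x y : ZSet} (h : x ∈ y) (hy : y ∈ V_ θ) : x ∈ V_ θ :=
  (isTransitive_vonNeumann θ).mem_trans h hy

theorem pair_mem_vonNeumann (hθ : IsSuccLimit θ) {x y : ZSet} (hx : x ∈ V_ θ) (hy : y ∈ V_ θ) :
    ({x, y} : ZSet) ∈ V_ θ := by
  rw [mem_vonNeumann] at *
  rw [ZFSet.rank_pair]
  exact max_lt (hθ.succ_lt hx) (hθ.succ_lt hy)

theorem kuratowskiPair_mem_vonNeumann (hθ : IsSuccLimit θ) {x y : ZSet} (hx : x ∈ V_ θ)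
    (hy : y ∈ V_ θ) : pair x y ∈ V_ θ := by
  refine pair_mem_vonNeumann hθ ?_ (pair_mem_vonNeumann hθ hx hy)
  rw [← ZFSet.pair_eq_singleton]
  exact pair_mem_vonNeumann hθ hx hx

theorem powerset_mem_vonNeumann (hθ : IsSuccLimit θ) {x : ZSet} (hx : x ∈ V_ θ) :
    powerset x ∈ V_ θ := by
  rw [mem_vonNeumann] at *
  rw [ZFSet.rank_powerset]
  exact hθ.succ_lt hx

theorem prod_mem_vonNeumann (hθ : IsSuccLimit θ) {x y : ZSet} (hx : x ∈ V_ θ) (hy : y ∈ V_ θ) :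
    prod x y ∈ V_ θ := by
  have hxy : x ∪ y ∈ V_ θ := by
    rw [mem_vonNeumann] at *
    rw [ZFSet.rank_union]
    exact max_lt hx hy
  refine mem_vonNeumann_of_subset (fun z hz => ?_)
    (powerset_mem_vonNeumann hθ (powerset_mem_vonNeumann hθ hxy))
  obtain ⟨a, ha, b, hb, rfl⟩ := ZFSet.mem_prod.1 hz
  rw [ZFSet.mem_powerset, pair]
  intro u hu
  rw [ZFSet.mem_powerset]
  intro t ht
  rw [ZFSet.mem_union]
  rcases ZFSet.mem_pair.1 hu with rfl | rfl
  · exact .inl (ZFSet.mem_singleton.1 ht ▸ ha)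
  · exact (ZFSet.mem_pair.1 ht).imp (fun h : t = a => h ▸ ha) fun h : t = b => h ▸ hb

theorem isPairIn_pair (hθ : IsSuccLimit θ) {a b : ZSet} (ha : a ∈ V_ θ) (hb : b ∈ V_ θ) :
    IsPairIn (V_ θ) (pair a b) a b := by
  intro u hu
  have hext : ∀ {s : ZSet}, s ∈ V_ θ → ((∀ t ∈ V_ θ, t ∈ u ↔ t ∈ s) ↔ u = s) := by
    refine fun {s} hs => ⟨fun h => ZFSet.ext fun t => ⟨fun ht => ?_, fun ht => ?_⟩, ?_⟩
    · exact (h t (mem_vonNeumann_of_mem ht hu)).1 ht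
    · exact (h t (mem_vonNeumann_of_mem ht hs)).2 ht
    · rintro rfl t _
      rfl
  have h₁ := hext (pair_mem_vonNeumann hθ ha ha)
  have h₂ := hext (pair_mem_vonNeumann hθ ha hb)
  simp only [ZFSet.pair_eq_singleton, ZFSet.mem_singleton, ZFSet.mem_pair] at h₁ h₂
  rw [h₁, h₂, pair, ZFSet.mem_pair]

theorem isPairIn_vonNeumann (hθ : IsSuccLimit θ) {z a b : ZSet} (hz : z ∈ V_ θ) (ha : a ∈ V_ θ)
    (hb : b ∈ V_ θ) : IsPairIn (V_ θ) z a b ↔ z = pair a b := by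
  refine ⟨fun h => ZFSet.ext fun u => ?_, fun h => h ▸ isPairIn_pair hθ ha hb⟩
  have hp := kuratowskiPair_mem_vonNeumann hθ ha hb
  refine ⟨fun hu => ?_, fun hu => ?_⟩
  · have huW := mem_vonNeumann_of_mem hu hz
    exact (isPairIn_pair hθ ha hb u huW).2 ((h u huW).1 hu)
  · have huW := mem_vonNeumann_of_mem hu hp
    exact (h u huW).2 ((isPairIn_pair hθ ha hb u huW).1 hu)

theorem pairMemIn_vonNeumann (hθ : IsSuccLimit θ) {p a b : ZSet} (hp : p ∈ V_ θ) (ha : a ∈ V_ θ)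
    (hb : b ∈ V_ θ) : PairMemIn (V_ θ) p a b ↔ pair a b ∈ p := by
  constructor
  · rintro ⟨z, hz, hzp, h⟩
    exact (isPairIn_vonNeumann hθ hz ha hb).1 h ▸ hzp
  · exact fun h => ⟨_, mem_vonNeumann_of_mem h hp, h, isPairIn_pair hθ ha hb⟩

theorem isOrdinalIn_vonNeumann {v : ZSet} (hv : v ∈ V_ θ) :
    IsOrdinalIn (V_ θ) v ↔ v.IsOrdinal := by
  constructor
  · rintro ⟨h₁, h₂⟩
    refine ⟨fun y hy z hz => ?_, fun {x y z} hxy hyz hz => ?_⟩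
    · have hyW := mem_vonNeumann_of_mem hy hv
      exact h₁ y hyW hy z (mem_vonNeumann_of_mem hz hyW) hz
    · have hzW := mem_vonNeumann_of_mem hz hv
      have hyW := mem_vonNeumann_of_mem hyz hzW
      exact h₂ z hzW hz y hyW hyz x (mem_vonNeumann_of_mem hxy hyW) hxy
  · exact fun h => ⟨fun y _ hy z _ hz => h.mem_trans hz hy,
      fun z _ hz y _ hyz x _ hxy => (h.mem hz).mem_trans hxy hyz⟩

theorem forall_mem_vonNeumann_iff_subset {y u : ZSet} (hy : y ∈ V_ θ) :
    (∀ t ∈ V_ θ, t ∈ y → t ∈ u) ↔ y ⊆ u :=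
  ⟨fun h t ht => h t (mem_vonNeumann_of_mem ht hy) ht, fun h _ _ ht => h ht⟩

/-- A set whose members are the subsets of certain stages is itself a stage. -/
theorem eq_vonNeumann_rank {z : ZSet} (hz : z ∈ V_ θ) {P : ZSet → Prop}
    (hP : ∀ u ∈ V_ θ, P u → ∃ o, u = V_ o)
    (h : ∀ y ∈ V_ θ, y ∈ z ↔ ∃ u ∈ V_ θ, P u ∧ y ⊆ u) : z = V_ z.rank := by
  refine ZFSet.ext fun y => ⟨fun hy => subset_vonNeumann_self z hy, fun hy => ?_⟩
  rw [mem_vonNeumann, ZFSet.lt_rank_iff] at hy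
  obtain ⟨x, hx, hyx⟩ := hy
  obtain ⟨u, hu, hPu, hxu⟩ := (h x (mem_vonNeumann_of_mem hx hz)).1 hx
  obtain ⟨o, rfl⟩ := hP u hu hPu
  have hyo : y ⊆ V_ o := subset_vonNeumann.2 (hyx.trans (subset_vonNeumann.1 hxu))
  exact (h y (mem_vonNeumann_of_subset hyo hu)).2 ⟨_, hu, hPu, hyo⟩

theorem IsStageIn.exists_eq_vonNeumann {v : ZSet} (hv : v ∈ V_ θ) (h : IsStageIn (V_ θ) v) :
    ∃ o, v = V_ o := by
  obtain ⟨H, hH, h₁, h₂⟩ := h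
  have key : ∀ z, z ∈ H → ∃ o, z = V_ o := by
    intro z
    induction z using ZFSet.inductionOn with
    | h z ih =>
      intro hz
      have hzW := mem_vonNeumann_of_mem hz hH
      refine ⟨_, eq_vonNeumann_rank hzW (P := fun u => u ∈ H ∧ u ∈ z)
        (fun u _ hu => ih u hu.2 hu.1) fun y hy => (h₁ z hzW hz y hy).trans ?_⟩
      simp only [forall_mem_vonNeumann_iff_subset hy, and_assoc]
  refine ⟨_, eq_vonNeumann_rank hv (P := fun u => u ∈ H) (fun u _ hu => key u hu)
    fun y hy => (h₂ y hy).trans ?_⟩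
  simp only [forall_mem_vonNeumann_iff_subset hy]

theorem isStageIn_vonNeumann {o : Ordinal.{0}} (ho : o < θ) : IsStageIn (V_ θ) (V_ o) := by
  have hoW : V_ o ∈ V_ θ := vonNeumann_mem_of_lt ho
  have hmem : ∀ z : ZSet, z ∈ ZFSet.sep (fun z => ∃ β, z = V_ β) (V_ o) ↔ ∃ β < o, z = V_ β := by
    intro z
    rw [ZFSet.mem_sep]
    constructor
    · rintro ⟨hz, β, rfl⟩
      exact ⟨β, vonNeumann_mem_vonNeumann_iff.1 hz, rfl⟩
    · rintro ⟨β, hβ, rfl⟩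
      exact ⟨vonNeumann_mem_of_lt hβ, β, rfl⟩
  refine ⟨ZFSet.sep (fun z => ∃ β, z = V_ β) (V_ o),
    mem_vonNeumann_of_subset ZFSet.sep_subset hoW, fun z _ hz y hy => ?_, fun y hy => ?_⟩
  · obtain ⟨β, hβ, rfl⟩ := (hmem z).1 hz
    simp only [forall_mem_vonNeumann_iff_subset hy, hmem]
    rw [mem_vonNeumann']
    constructor
    · rintro ⟨γ, hγ, h⟩
      exact ⟨V_ γ, vonNeumann_mem_of_lt (hγ.trans (hβ.trans ho)), ⟨γ, hγ.trans hβ, rfl⟩,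
        vonNeumann_mem_of_lt hγ, h⟩
    · rintro ⟨_, _, ⟨γ, _, rfl⟩, hγ, h⟩
      exact ⟨γ, vonNeumann_mem_vonNeumann_iff.1 hγ, h⟩
  · simp only [forall_mem_vonNeumann_iff_subset hy, hmem]
    rw [mem_vonNeumann']
    constructor
    · rintro ⟨γ, hγ, h⟩
      exact ⟨V_ γ, vonNeumann_mem_of_lt (hγ.trans ho), ⟨γ, hγ, rfl⟩, h⟩
    · rintro ⟨_, _, ⟨γ, hγ, rfl⟩, h⟩
      exact ⟨γ, hγ, h⟩

end Absoluteness

/-! ### Generic embeddings and their internal counterparts -/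

section Embeddings

open ZFSet Order

variable {θ : Ordinal.{0}} {M' M k' k x' x : ZSet}

theorem fst_cons {n : ℕ} (c : ZSet × ZSet) (q : Fin n → ZSet × ZSet) :
    (fun i => ((Fin.cons c q : Fin (n + 1) → ZSet × ZSet) i).1) =
      (Fin.cons c.1 fun i => (q i).1 : Fin (n + 1) → ZSet) :=
  funext fun i => by refine Fin.cases rfl (fun _ => rfl) i

theorem snd_cons {n : ℕ} (c : ZSet × ZSet) (q : Fin n → ZSet × ZSet) :
    (fun i => ((Fin.cons c q : Fin (n + 1) → ZSet × ZSet) i).2) =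
      (Fin.cons c.2 fun i => (q i).2 : Fin (n + 1) → ZSet) :=
  funext fun i => by refine Fin.cases rfl (fun _ => rfl) i

/-- A back-and-forth family forces its members to preserve any given formula, after shrinking. -/
theorem IsBackAndForthIn.exists_preserving (hθ : IsSuccLimit θ) (hM' : M' ∈ V_ θ) (hM : M ∈ V_ θ)
    {F : ZSet} (hF : F ∈ V_ θ) (h : IsBackAndForthIn (V_ θ) M' M F) {n : ℕ} (φ : Fml n) :
    ∀ E ∈ F, ∃ E' ∈ F, E' ⊆ E ∧ ∀ p ∈ E', ∀ q : Fin n → ZSet × ZSet,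
      (∀ i, (q i).1 ∈ M' ∧ (q i).2 ∈ M ∧ pair (q i).1 (q i).2 ∈ p) →
      (Realize (setInterp M') φ (fun i => (q i).1) ↔
        Realize (setInterp M) φ (fun i => (q i).2)) := by
  have hpair : ∀ {E p a b : ZSet}, E ∈ F → p ∈ E → a ∈ M' → b ∈ M →
      (PairMemIn (V_ θ) p a b ↔ pair a b ∈ p) := fun hE hp ha hb =>
    pairMemIn_vonNeumann hθ (mem_vonNeumann_of_mem hp (mem_vonNeumann_of_mem hE hF))
      (mem_vonNeumann_of_mem ha hM') (mem_vonNeumann_of_mem hb hM)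
  have hiso : ∀ E ∈ F, ∀ p ∈ E, ∀ c d : ZSet × ZSet,
      (c.1 ∈ M' ∧ c.2 ∈ M ∧ pair c.1 c.2 ∈ p) → (d.1 ∈ M' ∧ d.2 ∈ M ∧ pair d.1 d.2 ∈ p) →
      (c.1 ∈ d.1 ↔ c.2 ∈ d.2) ∧ (c.1 = d.1 ↔ c.2 = d.2) := by
    intro E hE p hp c d hc hd
    have hEW := mem_vonNeumann_of_mem hE hF
    exact h.2.2 E hEW hE p (mem_vonNeumann_of_mem hp hEW) hp
      c.1 (mem_vonNeumann_of_mem hc.1 hM') c.2 (mem_vonNeumann_of_mem hc.2.1 hM)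
      ((hpair hE hp hc.1 hc.2.1).2 hc.2.2)
      d.1 (mem_vonNeumann_of_mem hd.1 hM') d.2 (mem_vonNeumann_of_mem hd.2.1 hM)
      ((hpair hE hp hd.1 hd.2.1).2 hd.2.2)
  induction φ with
  | mem i j => exact fun E hE => ⟨E, hE, fun _ => id, fun p hp q hq =>
      (hiso E hE p hp _ _ (hq i) (hq j)).1⟩
  | eq i j => exact fun E hE => ⟨E, hE, fun _ => id, fun p hp q hq =>
      (hiso E hE p hp _ _ (hq i) (hq j)).2⟩
  | pred k i => exact fun E hE => ⟨E, hE, fun _ => id, fun p hp q hq => Iff.rfl⟩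
  | not φ ih =>
    intro E hE
    obtain ⟨E', hE', hsub, hφ⟩ := ih E hE
    exact ⟨E', hE', hsub, fun p hp q hq => not_congr (hφ p hp q hq)⟩
  | and φ ψ ihφ ihψ =>
    intro E hE
    obtain ⟨E₁, hE₁, hsub₁, hφ⟩ := ihφ E hE
    obtain ⟨E₂, hE₂, hsub₂, hψ⟩ := ihψ E₁ hE₁
    exact ⟨E₂, hE₂, fun _ hz => hsub₁ (hsub₂ hz),
      fun p hp q hq => and_congr (hφ p (hsub₂ hp) q hq) (hψ p hp q hq)⟩
  | all φ ih =>
    intro E hE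
    obtain ⟨E₁, hE₁, hsub₁, hφ⟩ := ih E hE
    obtain ⟨E₂, hE₂W, hE₂, hsub₂, hext⟩ := h.2.1 E₁ (mem_vonNeumann_of_mem hE₁ hF) hE₁
    refine ⟨E₂, hE₂, fun p hp => hsub₁ (hsub₂ p (mem_vonNeumann_of_mem hp hE₂W) hp),
      fun p hp q hq => ?_⟩
    have hpW := mem_vonNeumann_of_mem hp hE₂W
    have step : ∀ {a b p'}, a ∈ M' → b ∈ M → p' ∈ E₁ → PairMemIn (V_ θ) p' a b →
        (∀ z ∈ V_ θ, z ∈ p → z ∈ p') →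
        (Realize (setInterp M') φ (Fin.cons a fun i => (q i).1) ↔
          Realize (setInterp M) φ (Fin.cons b fun i => (q i).2)) := by
      intro a b p' ha hb hp' hab hpp'
      have := hφ p' hp' (Fin.cons (a, b) q) (Fin.cases ⟨ha, hb, (hpair hE₁ hp' ha hb).1 hab⟩
        fun i => ⟨(hq i).1, (hq i).2.1,
          hpp' _ (mem_vonNeumann_of_mem (hq i).2.2 hpW) (hq i).2.2⟩)
      rwa [fst_cons, snd_cons] at this
    obtain ⟨hforth, hback⟩ := hext p hpW hp
    constructor
    · intro hr b hb
      obtain ⟨a, _, ha, p', _, hp', hab, hpp'⟩ := hback b (mem_vonNeumann_of_mem hb hM) hb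
      exact (step ha hb hp' hab hpp').1 (hr a ha)
    · intro hr a ha
      obtain ⟨b, _, hb, p', _, hp', hab, hpp'⟩ := hforth a (mem_vonNeumann_of_mem ha hM') ha
      exact (step ha hb hp' hab hpp').2 (hr b hb)

theorem HasEmbeddingIn.hasGenElemEmb (hθ : IsSuccLimit θ) (hM' : M' ∈ V_ θ) (hM : M ∈ V_ θ)
    (hk' : k' ∈ M') (hx' : x' ∈ M') (hk : k ∈ M) (hx : x ∈ M)
    (h : HasEmbeddingIn (V_ θ) M' k' x' M k x) :
    HasGenElemEmb (setInterp M') (setInterp M) [(k', k), (x', x)] (FixBelow k') := by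
  obtain ⟨S, hSW, F, hFW, ⟨p₀, hp₀W, hp₀, hk₀, hx₀⟩, hS, hF⟩ := h
  have hpair : ∀ {p a b : ZSet}, p ∈ S → a ∈ M' → b ∈ M →
      (PairMemIn (V_ θ) p a b ↔ pair a b ∈ p) := fun hp ha hb =>
    pairMemIn_vonNeumann hθ (mem_vonNeumann_of_mem hp hSW)
      (mem_vonNeumann_of_mem ha hM') (mem_vonNeumann_of_mem hb hM)
  refine ⟨{q | ∃ p ∈ S, ∀ i, (q.2 i).1 ∈ M' ∧ (q.2 i).2 ∈ M ∧ pair (q.2 i).1 (q.2 i).2 ∈ p},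
    ?_, ?_, ?_⟩
  · rintro ⟨n, q⟩ ⟨p, hp, hq⟩
    obtain ⟨_, hadm, hpF⟩ := hS p (mem_vonNeumann_of_mem hp hSW) hp
    refine ⟨⟨fun i => (hq i).1, fun i => (hq i).2.1, fun φ => ?_⟩, fun i hi => ?_⟩
    · obtain ⟨E, hEW, hE⟩ := hF.1
      obtain ⟨E', hE', -, hφ⟩ := hF.exists_preserving hθ hM' hM hFW φ E hE
      exact hφ p (hpF E' (mem_vonNeumann_of_mem hE' hFW) hE') q hq
    · exact (hadm _ (mem_vonNeumann_of_mem (hq i).1 hM') _ (mem_vonNeumann_of_mem (hq i).2.1 hM)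
        ((hpair hp (hq i).1 (hq i).2.1).2 (hq i).2.2)).2.2 hi.2
  · refine ⟨p₀, hp₀, fun i => ?_⟩
    fin_cases i
    · exact ⟨hk', hk, (hpair hp₀ hk' hk).1 hk₀⟩
    · exact ⟨hx', hx, (hpair hp₀ hx' hx).1 hx₀⟩
  · rintro ⟨n, q⟩ ⟨p, hp, hq⟩ a ha
    obtain ⟨b, _, hb, p', _, hp', hab, hpp'⟩ :=
      (hS p (mem_vonNeumann_of_mem hp hSW) hp).1 a (mem_vonNeumann_of_mem ha hM') ha
    refine ⟨b, hb, p', hp', Fin.lastCases ?_ fun i => ?_⟩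
    · simp only [Fin.snoc_last]
      exact ⟨ha, hb, (hpair hp' ha hb).1 hab⟩
    · simp only [Fin.snoc_castSucc]
      exact ⟨(hq i).1, (hq i).2.1, hpp' _ (mem_vonNeumann_of_mem (hq i).2.2
        (mem_vonNeumann_of_mem hp hSW)) (hq i).2.2⟩

/-- The set of pairs listed by a finite sequence. -/
noncomputable def graph {n : ℕ} (q : Fin n → ZSet × ZSet) : ZSet :=
  ZFSet.range fun i => pair (q i).1 (q i).2

theorem mem_graph {n : ℕ} {q : Fin n → ZSet × ZSet} {z : ZSet} :
    z ∈ graph q ↔ ∃ i, pair (q i).1 (q i).2 = z := by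
  simp [graph]

theorem pair_mem_graph {n : ℕ} {q : Fin n → ZSet × ZSet} {a b : ZSet} :
    pair a b ∈ graph q ↔ ∃ i, q i = (a, b) := by
  simp [mem_graph, Prod.ext_iff]

theorem graph_mem_powerset {n : ℕ} {q : Fin n → ZSet × ZSet}
    (hq : ∀ i, (q i).1 ∈ M' ∧ (q i).2 ∈ M) : graph q ∈ powerset (prod M' M) := by
  rw [ZFSet.mem_powerset]
  intro z hz
  obtain ⟨i, rfl⟩ := mem_graph.1 hz
  exact ZFSet.pair_mem_prod.2 (hq i)

/-- The graphs of the finite sequences in `M' × M` that preserve types of quantifier rank `j`. -/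
noncomputable def rankFamily (M' M : ZSet) (j : ℕ) : ZSet :=
  (powerset (prod M' M)).sep fun p => ∃ (n : ℕ) (q : Fin n → ZSet × ZSet), p = graph q ∧
    (∀ i, (q i).1 ∈ M' ∧ (q i).2 ∈ M) ∧
    rankType j M' (fun i => (q i).1) = rankType j M (fun i => (q i).2)

theorem graph_mem_rankFamily {j : ℕ} {n : ℕ} {q : Fin n → ZSet × ZSet}
    (hq : ∀ i, (q i).1 ∈ M' ∧ (q i).2 ∈ M)
    (h : rankType j M' (fun i => (q i).1) = rankType j M (fun i => (q i).2)) :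
    graph q ∈ rankFamily M' M j :=
  ZFSet.mem_sep.2 ⟨graph_mem_powerset hq, n, q, rfl, hq, h⟩

theorem rankType_succ_eq_iff {j n : ℕ} {v w : Fin n → ZSet} :
    rankType (j + 1) M' v = rankType (j + 1) M w ↔
      (∀ a ∈ M', ∃ b ∈ M, rankType j M' (Fin.cons a v : Fin (n + 1) → ZSet) =
        rankType j M (Fin.cons b w : Fin (n + 1) → ZSet)) ∧
      ∀ b ∈ M, ∃ a ∈ M', rankType j M' (Fin.cons a v : Fin (n + 1) → ZSet) =
        rankType j M (Fin.cons b w : Fin (n + 1) → ZSet) := by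
  refine (Set.ext_iff
    (a := {t | ∃ x ∈ M', rankType j M' (Fin.cons x v : Fin (n + 1) → ZSet) = t})
    (b := {t | ∃ x ∈ M, rankType j M (Fin.cons x w : Fin (n + 1) → ZSet) = t})).trans ?_
  constructor
  · intro h
    refine ⟨fun a ha => ?_, fun b hb => (h _).2 ⟨b, hb, rfl⟩⟩
    obtain ⟨b, hb, hab⟩ := (h _).1 ⟨a, ha, rfl⟩
    exact ⟨b, hb, hab.symm⟩
  · rintro ⟨h₁, h₂⟩ t
    constructor
    · rintro ⟨a, ha, rfl⟩
      obtain ⟨b, hb, hab⟩ := h₁ a ha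
      exact ⟨b, hb, hab.symm⟩
    · rintro ⟨b, hb, rfl⟩
      exact h₂ b hb

theorem rankType_zero_eq_iff {n : ℕ} {v w : Fin n → ZSet} :
    rankType 0 M' v = rankType 0 M w ↔
      ∀ i j, (v i ∈ v j ↔ w i ∈ w j) ∧ (v i = v j ↔ w i = w j) := by
  constructor
  · intro h i j
    have := Prod.ext_iff.1 (congrFun (congrFun h i) j)
    exact ⟨Iff.of_eq this.1, Iff.of_eq this.2⟩
  · intro h
    funext i j
    exact Prod.ext (propext (h i j).1) (propext (h i j).2)

theorem rankType_eq_of_succ {j n : ℕ} {v w : Fin n → ZSet} (hM' : ∃ a, a ∈ M')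
    (h : rankType (j + 1) M' v = rankType (j + 1) M w) : rankType j M' v = rankType j M w := by
  induction j generalizing n with
  | zero =>
    obtain ⟨a, ha⟩ := hM'
    obtain ⟨b, _, hab⟩ := (rankType_succ_eq_iff.1 h).1 a ha
    exact rankType_zero_eq_iff.2 fun i j => rankType_zero_eq_iff.1 hab i.succ j.succ
  | succ j ih =>
    obtain ⟨h₁, h₂⟩ := rankType_succ_eq_iff.1 h
    refine rankType_succ_eq_iff.2 ⟨fun a ha => ?_, fun b hb => ?_⟩
    · obtain ⟨b, hb, hab⟩ := h₁ a ha
      exact ⟨b, hb, ih hab⟩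
    · obtain ⟨a, ha, hab⟩ := h₂ b hb
      exact ⟨a, ha, ih hab⟩

theorem rankType_zero_eq {j n : ℕ} {v w : Fin n → ZSet} (hM' : ∃ a, a ∈ M')
    (h : rankType j M' v = rankType j M w) : rankType 0 M' v = rankType 0 M w := by
  induction j with
  | zero => exact h
  | succ j ih => exact ih (rankType_eq_of_succ hM' h)

theorem rankFamily_mem_vonNeumann (hθ : IsSuccLimit θ) (hM' : M' ∈ V_ θ) (hM : M ∈ V_ θ) (j : ℕ) :
    rankFamily M' M j ∈ V_ θ :=
  mem_vonNeumann_of_subset ZFSet.sep_subset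
    (powerset_mem_vonNeumann hθ (prod_mem_vonNeumann hθ hM' hM))

/-- The families of finite sequences preserving types of bounded quantifier rank form a
back-and-forth family. -/
theorem isBackAndForthIn_rankFamily (hθ : IsSuccLimit θ) (hM' : M' ∈ V_ θ) (hM : M ∈ V_ θ)
    (hne : ∃ a, a ∈ M') {F : ZSet} (hF : ∀ E, E ∈ F ↔ ∃ j, E = rankFamily M' M j) :
    IsBackAndForthIn (V_ θ) M' M F := by
  have hW := rankFamily_mem_vonNeumann hθ hM' hM
  have hext : ∀ {j n : ℕ} {q : Fin n → ZSet × ZSet} {a b : ZSet},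
      (∀ i, (q i).1 ∈ M' ∧ (q i).2 ∈ M) → a ∈ M' → b ∈ M →
      rankType j M' (Fin.cons a fun i => (q i).1 : Fin (n + 1) → ZSet) =
        rankType j M (Fin.cons b fun i => (q i).2 : Fin (n + 1) → ZSet) →
      ∃ p' ∈ V_ θ, p' ∈ rankFamily M' M j ∧ PairMemIn (V_ θ) p' a b ∧
        ∀ z ∈ V_ θ, z ∈ graph q → z ∈ p' := by
    intro j n q a b hq ha hb h
    have hmem : graph (Fin.cons (a, b) q : Fin (n + 1) → ZSet × ZSet) ∈ rankFamily M' M j := by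
      refine graph_mem_rankFamily (Fin.cases ⟨ha, hb⟩ hq) ?_
      rwa [fst_cons, snd_cons]
    have hmemW := mem_vonNeumann_of_mem hmem (hW j)
    refine ⟨_, hmemW, hmem, ?_, fun z _ hz => ?_⟩
    · exact (pairMemIn_vonNeumann hθ hmemW (mem_vonNeumann_of_mem ha hM')
        (mem_vonNeumann_of_mem hb hM)).2 (pair_mem_graph.2 ⟨0, rfl⟩)
    · obtain ⟨i, rfl⟩ := mem_graph.1 hz
      exact pair_mem_graph.2 ⟨i.succ, rfl⟩
  refine ⟨⟨_, hW 0, (hF _).2 ⟨0, rfl⟩⟩, fun E _ hE => ?_, fun E _ hE p hpW hp => ?_⟩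
  · obtain ⟨j, rfl⟩ := (hF E).1 hE
    refine ⟨_, hW (j + 1), (hF _).2 ⟨j + 1, rfl⟩, fun p _ hp => ?_, fun p _ hp => ?_⟩
    · obtain ⟨-, n, q, rfl, hq, h⟩ := ZFSet.mem_sep.1 hp
      exact graph_mem_rankFamily hq (rankType_eq_of_succ hne h)
    · obtain ⟨-, n, q, rfl, hq, h⟩ := ZFSet.mem_sep.1 hp
      obtain ⟨h₁, h₂⟩ := rankType_succ_eq_iff.1 h
      constructor
      · intro a _ ha
        obtain ⟨b, hb, hab⟩ := h₁ a ha
        exact ⟨b, mem_vonNeumann_of_mem hb hM, hb, hext hq ha hb hab⟩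
      · intro b _ hb
        obtain ⟨a, ha, hab⟩ := h₂ b hb
        exact ⟨a, mem_vonNeumann_of_mem ha hM', ha, hext hq ha hb hab⟩
  · obtain ⟨j, rfl⟩ := (hF E).1 hE
    obtain ⟨-, n, q, rfl, hq, h⟩ := ZFSet.mem_sep.1 hp
    intro a ha b hb hab c hc d hd hcd
    rw [pairMemIn_vonNeumann hθ hpW ha hb, pair_mem_graph] at hab
    rw [pairMemIn_vonNeumann hθ hpW hc hd, pair_mem_graph] at hcd
    obtain ⟨i, hi⟩ := hab
    obtain ⟨l, hl⟩ := hcd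
    have := rankType_zero_eq_iff.1 (rankType_zero_eq hne h) i l
    simpa only [hi, hl] using this

theorem HasEmbeddingIn.of_hasGenElemEmb (hθ : IsSuccLimit θ) (hM' : M' ∈ V_ θ) (hM : M ∈ V_ θ)
    (hord : k'.IsOrdinal)
    (h : HasGenElemEmb (setInterp M') (setInterp M) [(k', k), (x', x)] (FixBelow k')) :
    HasEmbeddingIn (V_ θ) M' k' x' M k x := by
  obtain ⟨S, hS, hbase, hext⟩ := h
  have hPW : powerset (prod M' M) ∈ V_ θ :=
    powerset_mem_vonNeumann hθ (prod_mem_vonNeumann hθ hM' hM)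
  have hdom : ∀ {q}, q ∈ S → ∀ i, (q.2 i).1 ∈ M' ∧ (q.2 i).2 ∈ M := fun hq i =>
    ⟨(hS _ hq).1.1 i, (hS _ hq).1.2.1 i⟩
  have hbase' := hdom hbase
  have hk' : k' ∈ M' := (hbase' (0 : Fin 2)).1
  have hk : k ∈ M := (hbase' (0 : Fin 2)).2
  have hx' : x' ∈ M' := (hbase' (1 : Fin 2)).1
  have hx : x ∈ M := (hbase' (1 : Fin 2)).2
  let T : ZSet := (powerset (prod M' M)).sep fun p => ∃ q ∈ S, p = graph q.2
  let F : ZSet := (powerset (powerset (prod M' M))).sep fun E => ∃ j, E = rankFamily M' M j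
  have hTW : T ∈ V_ θ := mem_vonNeumann_of_subset ZFSet.sep_subset hPW
  have hFW : F ∈ V_ θ :=
    mem_vonNeumann_of_subset ZFSet.sep_subset (powerset_mem_vonNeumann hθ hPW)
  have hF : ∀ E, E ∈ F ↔ ∃ j, E = rankFamily M' M j := by
    refine fun E => ZFSet.mem_sep.trans ⟨And.right, fun h => ⟨?_, h⟩⟩
    obtain ⟨j, rfl⟩ := h
    exact ZFSet.mem_powerset.2 ZFSet.sep_subset
  have hT : ∀ {q}, q ∈ S → graph q.2 ∈ T := fun {q} hq =>
    ZFSet.mem_sep.2 ⟨graph_mem_powerset (hdom hq), q, hq, rfl⟩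
  have hpair : ∀ {p a b : ZSet}, p ∈ T → a ∈ M' → b ∈ M →
      (PairMemIn (V_ θ) p a b ↔ pair a b ∈ p) := fun hp ha hb =>
    pairMemIn_vonNeumann hθ (mem_vonNeumann_of_mem hp hTW)
      (mem_vonNeumann_of_mem ha hM') (mem_vonNeumann_of_mem hb hM)
  refine ⟨T, hTW, F, hFW, ⟨_, mem_vonNeumann_of_mem (hT hbase) hTW, hT hbase,
    (hpair (hT hbase) hk' hk).2 (pair_mem_graph.2 ⟨(0 : Fin 2), rfl⟩),
    (hpair (hT hbase) hx' hx).2 (pair_mem_graph.2 ⟨(1 : Fin 2), rfl⟩)⟩, fun p hpW hp => ?_,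
    isBackAndForthIn_rankFamily hθ hM' hM ⟨k', hk'⟩ hF⟩
  obtain ⟨-, q, hq, rfl⟩ := ZFSet.mem_sep.1 hp
  refine ⟨fun a _ ha => ?_, fun a ha b hb hab => ?_, fun E _ hE => ?_⟩
  · obtain ⟨b, hb, hq'⟩ := hext q hq a ha
    refine ⟨b, mem_vonNeumann_of_mem hb hM, hb, _, mem_vonNeumann_of_mem (hT hq') hTW, hT hq',
      (hpair (hT hq') ha hb).2 (pair_mem_graph.2 ⟨Fin.last _, by simp only [Fin.snoc_last]⟩),
      fun z _ hz => ?_⟩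
    obtain ⟨i, rfl⟩ := mem_graph.1 hz
    exact pair_mem_graph.2 ⟨i.castSucc, by simp only [Fin.snoc_castSucc]⟩
  · rw [pairMemIn_vonNeumann hθ hpW ha hb, pair_mem_graph] at hab
    obtain ⟨i, hi⟩ := hab
    have h₁ := hdom hq i
    have h₂ := (hS q hq).2 i
    rw [hi] at h₁ h₂
    exact ⟨h₁.1, h₁.2, fun hak => h₂ ⟨hord.mem hak, hak⟩⟩
  · obtain ⟨j, rfl⟩ := (hF E).1 hE
    exact graph_mem_rankFamily (hdom hq) ((hS q hq).1.rankType_eq j)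

/-- A member of a safe set does not decrease ranks. -/
theorem rank_le_of_safe {α β : Ordinal.{0}} {S : Set ((n : ℕ) × (Fin n → ZSet × ZSet))}
    (hS : ∀ q ∈ S, IsElemSeq (setInterp (V_ α)) (setInterp (V_ β)) q.2)
    (hext : ∀ q ∈ S, ∀ a ∈ V_ α, ∃ b ∈ V_ β,
      (⟨q.1 + 1, Fin.snoc q.2 (a, b)⟩ : (n : ℕ) × (Fin n → ZSet × ZSet)) ∈ S)
    {q : (n : ℕ) × (Fin n → ZSet × ZSet)} (hq : q ∈ S) (i : Fin q.1) :
    (q.2 i).1.rank ≤ (q.2 i).2.rank := by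
  generalize ha : (q.2 i).1 = a
  induction a using ZFSet.inductionOn generalizing q with
  | h a ih =>
    rw [ZFSet.rank_le_iff]
    intro c hc
    have haα : a ∈ V_ α := ha ▸ (hS q hq).1 i
    obtain ⟨d, _, hq'⟩ := hext q hq c (mem_vonNeumann_of_mem hc haα)
    have hmem := (hS _ hq').mem_iff_mem (Fin.last _) i.castSucc
    have hle := ih c hc hq' (Fin.last _)
    simp only [Fin.snoc_last, Fin.snoc_castSucc, ha] at hmem hle
    exact (hle trivial).trans_lt (ZFSet.rank_lt_of_mem (hmem.1 hc))

/-- A generic elementary embedding between stages restricts to the members of its domain. -/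
theorem hasGenElemEmb_restrict {α β : Ordinal.{0}} {S : Set ((n : ℕ) × (Fin n → ZSet × ZSet))}
    (hS : ∀ q ∈ S, IsElemSeq (setInterp (V_ α)) (setInterp (V_ β)) q.2 ∧
      ∀ i, FixBelow k' (q.2 i).1 (q.2 i).2)
    (hext : ∀ q ∈ S, ∀ a ∈ V_ α, ∃ b ∈ V_ β,
      (⟨q.1 + 1, Fin.snoc q.2 (a, b)⟩ : (n : ℕ) × (Fin n → ZSet × ZSet)) ∈ S)
    {q : (n : ℕ) × (Fin n → ZSet × ZSet)} (hq : q ∈ S) (hqk : (k', k) ∈ Set.range q.2)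
    (hqM : (M', M) ∈ Set.range q.2) (hqx : (x', x) ∈ Set.range q.2) (hk' : k' ∈ M')
    (hx' : x' ∈ M') :
    HasGenElemEmb (setInterp M') (setInterp M) [(k', k), (x', x)] (FixBelow k') := by
  refine ⟨{r | (∀ i, (r.2 i).1 ∈ M') ∧
    ∃ q ∈ S, (M', M) ∈ Set.range q.2 ∧ ∀ i, r.2 i ∈ Set.range q.2}, ?_, ?_, ?_⟩
  · rintro ⟨n, r⟩ ⟨hr, q, hq, ⟨i₀, hi₀⟩, hrq⟩
    dsimp only at hr hrq
    choose f hf using hrq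
    obtain ⟨helem, hfix⟩ := hS q hq
    refine ⟨⟨hr, fun i => ?_, fun φ => ?_⟩, fun i => by simpa only [hf] using hfix (f i)⟩
    · have := helem.mem_iff_mem (f i) i₀
      rw [hi₀, hf] at this
      exact this.1 (hr i)
    · have h := helem.iff_of_uniformlyDefinable (UniformlyDefinable.realize_inter φ f i₀)
      have hinter : ∀ {γ : Ordinal.{0}} {N : ZSet}, N ∈ V_ γ →
          {z : ZSet | z ∈ V_ γ ∧ z ∈ N} = {z | z ∈ N} := fun hN =>
        Set.ext fun z => ⟨And.right, fun hz => ⟨mem_vonNeumann_of_mem hz hN, hz⟩⟩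
      have h₁ : M' ∈ V_ α := by simpa [hi₀, memInterp] using helem.1 i₀
      have h₂ : M ∈ V_ β := by simpa [hi₀, memInterp] using helem.2.1 i₀
      simpa only [hi₀, hf, hinter h₁, hinter h₂] using h
  · refine ⟨fun i => ?_, q, hq, hqM, fun i => ?_⟩
    · fin_cases i
      exacts [hk', hx']
    · fin_cases i
      exacts [hqk, hqx]
  · rintro ⟨n, r⟩ ⟨hr, q, hq, ⟨i₀, hi₀⟩, hrq⟩ a ha
    have hM'α : M' ∈ V_ α := by simpa [hi₀, memInterp] using (hS q hq).1.1 i₀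
    obtain ⟨b, _, hq'⟩ := hext q hq a (mem_vonNeumann_of_mem ha hM'α)
    have hmem := (hS _ hq').1.mem_iff_mem (Fin.last _) i₀.castSucc
    simp only [Fin.snoc_last, Fin.snoc_castSucc, hi₀] at hmem
    refine ⟨b, hmem.1 ha, fun i => ?_, _, hq', ⟨i₀.castSucc, by
      simpa only [Fin.snoc_castSucc] using hi₀⟩, fun i => ?_⟩ <;>
      refine Fin.lastCases ?_ (fun i => ?_) i
    · simp only [Fin.snoc_last]
      exact ha
    · simpa only [Fin.snoc_castSucc] using hr i
    · exact ⟨Fin.last _, by simp only [Fin.snoc_last]⟩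
    · obtain ⟨l, hl⟩ := hrq i
      exact ⟨l.castSucc, by simpa only [Fin.snoc_castSucc] using hl⟩

end Embeddings


/-! ### Prescribing an element of the range -/

section Range

open ZFSet Order

/-- An embedding of a stage of limit rank above `l` yields embeddings into the stage of rank `l`
with a prescribed element in the range. -/
theorem exists_hasGenElemEmb_of_isSuccLimit {α θ l : Ordinal.{0}} (hθ : IsSuccLimit θ)
    (hlθ : l < θ) {k k' x : ZSet} (hk : k ∈ V_ l) (hx : x ∈ V_ l) (hord : k'.IsOrdinal)
    (hne : k' ≠ k)
    (h : HasGenElemEmb (setInterp (V_ α)) (setInterp (V_ θ)) [(k', k)] (FixBelow k')) :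
    ∃ (o : Ordinal.{0}) (k' x' : ZSet), k'.IsOrdinal ∧ k' ≠ k ∧ x' ∈ V_ o ∧
      HasGenElemEmb (setInterp (V_ o)) (setInterp (V_ l)) [(k', k), (x', x)] (FixBelow k') := by
  by_contra hno
  have hMW : V_ l ∈ V_ θ := vonNeumann_mem_of_lt hlθ
  have hcounter : IsCounterexampleIn (V_ θ) k (V_ l) x := by
    refine ⟨isStageIn_vonNeumann hlθ, hk, hx, fun M' hM' k' hk'W x' _ hst hk'o hk'k hk' hx' he => ?_⟩
    obtain ⟨o, rfl⟩ := hst.exists_eq_vonNeumann hM'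
    exact hno ⟨o, k', x', (isOrdinalIn_vonNeumann hk'W).1 hk'o, hk'k, hx',
      he.hasGenElemEmb hθ hM' hMW hk' hx' hk hx⟩
  obtain ⟨S, hS, hbase, hext⟩ := h
  have hdef : UniformlyDefinable (n := 1)
      (fun W w => ∃ M ∈ W, ∃ x ∈ W, IsCounterexampleIn W (w 0) M x) :=
    .ex <| .ex <| .isCounterexampleIn (2 : Fin 3) 1 0
  obtain ⟨M', hM', x', hx', hcounter'⟩ := ((hS _ hbase).1.iff_of_uniformlyDefinable hdef).2
    ⟨_, hMW, x, mem_vonNeumann_of_mem hx hMW, hcounter⟩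
  obtain ⟨M₁, hM₁, hq₁⟩ := hext _ hbase M' hM'
  obtain ⟨x₁, hx₁, hq₂⟩ := hext _ hq₁ x' hx'
  have hcounter₁ : IsCounterexampleIn (V_ θ) k M₁ x₁ :=
    ((hS _ hq₂).1.iff_of_uniformlyDefinable
      (UniformlyDefinable.isCounterexampleIn (0 : Fin 3) 1 2)).1 hcounter'
  obtain ⟨o, rfl⟩ := hcounter'.1.exists_eq_vonNeumann hM'
  have hle := rank_le_of_safe (fun q hq => (hS q hq).1) hext hq₂ (1 : Fin 3)
  have hoθ : o < θ := by
    have h₁ : (V_ o).rank ≤ M₁.rank := hle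
    rw [rank_vonNeumann] at h₁
    exact h₁.trans_lt (mem_vonNeumann.1 hM₁)
  have hM'θ : V_ o ∈ V_ θ := vonNeumann_mem_of_lt hoθ
  have hk'θ := mem_vonNeumann_of_mem hcounter'.2.1 hM'θ
  refine hcounter₁.2.2.2 _ hM'θ k' hk'θ x' (mem_vonNeumann_of_mem hcounter'.2.2.1 hM'θ)
    (isStageIn_vonNeumann hoθ) ((isOrdinalIn_vonNeumann hk'θ).2 hord) hne hcounter'.2.1
    hcounter'.2.2.1 (.of_hasGenElemEmb hθ hM'θ hM₁ hord ?_)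
  exact hasGenElemEmb_restrict hS hext hq₂ ⟨(0 : Fin 3), rfl⟩ ⟨(1 : Fin 3), rfl⟩
    ⟨(2 : Fin 3), rfl⟩ hcounter'.2.1 hcounter'.2.2.1

end Range

end GVP

open GVP in
/-- If `κ` is weakly remarkable, then for every ordinal
`λ > κ` and every `x ∈ V_λ` there are an ordinal `λ̄` and a generic elementary
embedding `j : V_λ̄ → V_λ` with `j (crit j) = κ` and `x ∈ ran j`. -/
theorem weaklyRemarkable_embedding_with_range
    (κ : ZSet) (hcard : ZCardIn Set.univ κ) (hwr : WeaklyRemarkableIn Set.univ κ) :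
    ∀ l : ZSet, l.IsOrdinal → κ ∈ l → ∀ x ∈ VstageZ l,
      ∃ lbar kbar y : ZSet, lbar.IsOrdinal ∧ kbar.IsOrdinal ∧ kbar ≠ κ ∧
        y ∈ VstageIn Set.univ lbar ∧
        HasGenElemEmb (memInterp (VstageIn Set.univ lbar))
          (memInterp (VstageIn Set.univ l)) [(kbar, κ), (y, x)] (FixBelow kbar) := by
  intro l hl hκ x hx
  have hθ : Order.IsSuccLimit (l.rank + Ordinal.omega0) :=
    Ordinal.isSuccLimit_add _ Ordinal.isSuccLimit_omega0
  have hlθ : l.rank < l.rank + Ordinal.omega0 := lt_add_of_pos_right _ Ordinal.omega0_pos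
  have hκl : κ.rank < l.rank := ZFSet.rank_lt_of_mem hκ
  obtain ⟨lbar, kbar, -, -, hkbar, hne, h⟩ := hwr (l.rank + Ordinal.omega0).toZFSet
    (ZFSet.isOrdinal_toZFSet _) (Set.mem_univ _)
    ((hcard.1.rank_lt_iff_mem (ZFSet.isOrdinal_toZFSet _)).1
      (by rw [Ordinal.rank_toZFSet]; exact hκl.trans hlθ))
  simp only [vstageIn_univ, Ordinal.rank_toZFSet] at h
  obtain ⟨o, k', x', hk', hne', hx', h'⟩ := exists_hasGenElemEmb_of_isSuccLimit hθ hlθ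
    (ZFSet.mem_vonNeumann.2 hκl) ((mem_vstageZ x l).1 hx) hkbar hne h
  refine ⟨o.toZFSet, k', x', ZFSet.isOrdinal_toZFSet o, hk', hne', ?_⟩
  simp only [vstageIn_univ, Ordinal.rank_toZFSet]
  exact ⟨hx', h'⟩
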